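/- Let 0 → M' → M → M'' → 0 be a short exact sequence of sheaves of A-modules. If M is coherent over A and M' is locally finitely generated over A, then M'' is coherent over A. -/

import Mathlib

/-!
Finiteness conditions for sheaves of modules over a sheaf of rings on a
topological space `X`, following the paper. We use the Grothendieck topology
on `Opens X`; the restriction of a sheaf of modules to an open subset `U`
is given by `SheafOfModules.over`, and the further restriction of a sheaf of
`A|_U`-modules to a smaller open `V ≤ U` is given by pushforward to the
site `(J.over U).over V`.
-/

universe u

open CategoryTheory Limits TopologicalSpace

namespace CoherentSheaves

variable {X : TopCat.{u}} {R : Sheaf (Opens.grothendieckTopology X) RingCat.{u}}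

/-- The restriction of a sheaf of `A|_U`-modules to a smaller open `V ≤ U`. -/
noncomputable abbrev resOver {U : Opens X} (N : SheafOfModules.{u} (R.over U))
    {V : Opens X} (h : V ≤ U) :
    SheafOfModules.{u} ((R.over U).over (Over.mk (homOfLE h))) :=
  N.over (Over.mk (homOfLE h))

/-- The restriction of a morphism of sheaves of modules to an open subset `U`. -/
noncomputable abbrev resMap {M N : SheafOfModules.{u} R} (φ : M ⟶ N) (U : Opens X) :
    M.over U ⟶ N.over U :=
  (SheafOfModules.pushforward (𝟙 _)).map φ

/-- A sheaf of `A|_U`-modules `N` is locally finitely generated if every `x ∈ U` has an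
open neighborhood `V ≤ U` on which `N` admits an epimorphism from a finite free module. -/
def IsLFGOver {U : Opens X} (N : SheafOfModules.{u} (R.over U)) : Prop :=
  ∀ x ∈ U, ∃ (V : Opens X) (h : V ≤ U), x ∈ V ∧ ∃ n : ℕ, 0 < n ∧
    ∃ p : SheafOfModules.free (ULift.{u} (Fin n)) ⟶ resOver N h, Epi p

/-- A sheaf of `A|_U`-modules `N` is locally finitely presented if every `x ∈ U` has an
open neighborhood `V ≤ U` on which there is an exact sequence
`(A|_V)^{⊕m} ⟶ (A|_V)^{⊕n} ⟶ N|_V ⟶ 0`. -/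
def IsLFPOver {U : Opens X} (N : SheafOfModules.{u} (R.over U)) : Prop :=
  ∀ x ∈ U, ∃ (V : Opens X) (h : V ≤ U), x ∈ V ∧ ∃ m n : ℕ, 0 < m ∧ 0 < n ∧
    ∃ (f : (SheafOfModules.free (ULift.{u} (Fin m)) :
              SheafOfModules.{u} ((R.over U).over (Over.mk (homOfLE h)))) ⟶
             SheafOfModules.free (ULift.{u} (Fin n)))
      (p : SheafOfModules.free (ULift.{u} (Fin n)) ⟶ resOver N h)
      (w : f ≫ p = 0), Epi p ∧ (ShortComplex.mk f p w).Exact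

/-- A sheaf of `A`-modules `M` is locally finitely generated if every `x ∈ X` has an
open neighborhood `U` on which `M` admits an epimorphism from a finite free module. -/
def IsLFG (M : SheafOfModules.{u} R) : Prop :=
  ∀ x : X, ∃ U : Opens X, x ∈ U ∧ ∃ n : ℕ, 0 < n ∧
    ∃ p : SheafOfModules.free (ULift.{u} (Fin n)) ⟶ M.over U, Epi p

/-- A sheaf of `A`-modules `M` is locally finitely presented if every `x ∈ X` has an
open neighborhood `U` on which there is an exact sequence
`(A|_U)^{⊕m} ⟶ (A|_U)^{⊕n} ⟶ M|_U ⟶ 0`. -/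
def IsLFP (M : SheafOfModules.{u} R) : Prop :=
  ∀ x : X, ∃ U : Opens X, x ∈ U ∧ ∃ m n : ℕ, 0 < m ∧ 0 < n ∧
    ∃ (f : (SheafOfModules.free (ULift.{u} (Fin m)) :
              SheafOfModules.{u} (R.over U)) ⟶ SheafOfModules.free (ULift.{u} (Fin n)))
      (p : SheafOfModules.free (ULift.{u} (Fin n)) ⟶ M.over U)
      (w : f ≫ p = 0), Epi p ∧ (ShortComplex.mk f p w).Exact

/-- A sheaf of `A`-modules `M` is pseudo-coherent if for every open `U`, every locally
finitely generated `A|_U`-submodule of `M|_U` is locally finitely presented. -/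
def IsPseudoCoherent (M : SheafOfModules.{u} R) : Prop :=
  ∀ (U : Opens X) (N : SheafOfModules.{u} (R.over U)) (ι : N ⟶ M.over U),
    Mono ι → IsLFGOver N → IsLFPOver N

/-- A sheaf of `A`-modules is coherent if it is locally finitely generated
and pseudo-coherent. -/
def IsCoherent (M : SheafOfModules.{u} R) : Prop :=
  IsLFG M ∧ IsPseudoCoherent M

end CoherentSheaves

universe v' u'

open Opposite

namespace CoherentSheaves

section Site
variable {C : Type u'} [Category.{v'} C] (J : GrothendieckTopology C)

/-- A property of morphisms to `X` holds locally if it holds on some covering sieve. -/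
def Locally {X : C} (P : ∀ ⦃Y : C⦄, (Y ⟶ X) → Prop) : Prop :=
  ∃ S ∈ J X, ∀ ⦃Y : C⦄ (f : Y ⟶ X), S f → P f

namespace Locally
variable {J} {X : C} {P Q : ∀ ⦃Y : C⦄, (Y ⟶ X) → Prop}

lemma of_forall (h : ∀ ⦃Y : C⦄ (f : Y ⟶ X), P f) : Locally J P :=
  ⟨⊤, J.top_mem X, fun _ f _ ↦ h f⟩

lemma mono (h : Locally J P) (hPQ : ∀ ⦃Y : C⦄ (f : Y ⟶ X), P f → Q f) : Locally J Q :=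
  let ⟨S, hS, H⟩ := h
  ⟨S, hS, fun _ f hf ↦ hPQ f (H f hf)⟩

lemma and (hP : Locally J P) (hQ : Locally J Q) : Locally J (fun _ f ↦ P f ∧ Q f) :=
  let ⟨S, hS, H⟩ := hP
  let ⟨T, hT, K⟩ := hQ
  ⟨S ⊓ T, J.intersection_covering hS hT, fun _ f hf ↦ ⟨H f hf.1, K f hf.2⟩⟩

lemma bind (hP : Locally J P)
    (h : ∀ ⦃Y : C⦄ (f : Y ⟶ X), P f → Locally J (fun _ g ↦ Q (g ≫ f))) : Locally J Q := by
  obtain ⟨S, hS, H⟩ := hP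
  choose T hT K using fun ⦃Y : C⦄ (f : Y ⟶ X) (hf : S f) ↦ h f (H f hf)
  refine ⟨Sieve.bind S.arrows T, J.bind_covering hS fun Y f hf ↦ hT f hf, ?_⟩
  rintro Z _ ⟨Y, g, f, hf, hg, rfl⟩
  exact K f hf g hg

lemma forall_finite {I : Type*} [Finite I] {P : I → ∀ ⦃Y : C⦄, (Y ⟶ X) → Prop}
    (h : ∀ i, Locally J (P i)) : Locally J (fun _ f ↦ ∀ i, P i f) := by
  classical
  cases nonempty_fintype I
  suffices ∀ s : Finset I, Locally J (fun _ f ↦ ∀ i ∈ s, P i f) from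
    (this Finset.univ).mono fun _ f hf i ↦ hf i (Finset.mem_univ i)
  intro s
  induction s using Finset.induction_on with
  | empty => exact of_forall fun _ f i hi ↦ absurd hi (Finset.notMem_empty i)
  | insert a s _ ih =>
    exact ((h a).and ih).mono fun _ f hf i hi ↦ by
      obtain rfl | hi := Finset.mem_insert.1 hi
      exacts [hf.1, hf.2 i hi]

lemma of_left {U : C} {Y : Over U} {P : ∀ ⦃Z : C⦄, (Z ⟶ Y.left) → Prop} (h : Locally J P) :
    Locally (J.over U) (X := Y) (fun _ f ↦ P f.left) := by
  obtain ⟨S, hS, H⟩ := h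
  exact ⟨(Sieve.overEquiv Y).symm S, J.overEquiv_symm_mem_over Y S hS,
    fun Z f hf ↦ H _ ((Sieve.overEquiv_symm_iff S f).1 hf)⟩

end Locally
end Site

section Sections
variable {C : Type u'} [Category.{v'} C] {J : GrothendieckTopology C} {R : Sheaf J RingCat.{u}}

/-- The restriction of sections of a sheaf of rings. -/
def ringRes (R : Sheaf J RingCat.{u}) {X Y : C} (f : Y ⟶ X) :
    R.obj.obj (op X) →+* R.obj.obj (op Y) :=
  (R.obj.map f.op).hom

/-- The restriction of sections of a sheaf of modules. -/
noncomputable def res (M : SheafOfModules.{u} R) {X Y : C} (f : Y ⟶ X) :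
    M.val.obj (op X) →+ M.val.obj (op Y) :=
  AddMonoidHom.mk' (M.val.map f.op) fun a b ↦ map_add (M.val.map f.op).hom a b

/-- The action on sections of a morphism of sheaves of modules. -/
def appHom {M N : SheafOfModules.{u} R} (φ : M ⟶ N) (X : C) :
    M.val.obj (op X) →ₗ[R.obj.obj (op X)] N.val.obj (op X) :=
  (φ.val.app (op X)).hom

variable {M N : SheafOfModules.{u} R} {X Y Z : C}

lemma ringRes_comp (g : Z ⟶ Y) (f : Y ⟶ X) (r : R.obj.obj (op X)) :
    ringRes R (g ≫ f) r = ringRes R g (ringRes R f r) := by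
  simp [ringRes]

lemma res_comp (g : Z ⟶ Y) (f : Y ⟶ X) (s : M.val.obj (op X)) :
    res M (g ≫ f) s = res M g (res M f s) :=
  M.val.map_comp_apply f.op g.op s

lemma res_smul (f : Y ⟶ X) (r : R.obj.obj (op X)) (s : M.val.obj (op X)) :
    res M f (r • s) = ringRes R f r • res M f s :=
  M.val.map_smul f.op r s

lemma appHom_res (φ : M ⟶ N) (f : Y ⟶ X) (s : M.val.obj (op X)) :
    appHom φ Y (res M f s) = res N f (appHom φ X s) :=
  PresheafOfModules.naturality_apply φ.val f.op s

lemma appHom_comp {P : SheafOfModules.{u} R} (φ : M ⟶ N) (ψ : N ⟶ P) (s : M.val.obj (op X)) :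
    appHom (φ ≫ ψ) X s = appHom ψ X (appHom φ X s) := rfl

lemma appHom_zero (s : M.val.obj (op X)) : appHom (0 : M ⟶ N) X s = 0 := rfl

lemma appHom_sum {ι : Type*} (s : Finset ι) (φ : ι → (M ⟶ N)) (x : M.val.obj (op X)) :
    appHom (∑ i ∈ s, φ i) X x = ∑ i ∈ s, appHom (φ i) X x := by
  classical
  induction s using Finset.induction_on with
  | empty => rfl
  | insert a s ha ih => rw [Finset.sum_insert ha, Finset.sum_insert ha, ← ih]; rfl

lemma appHom_injective (φ : M ⟶ N) [Mono φ] (X : C) : Function.Injective (appHom φ X) :=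
  have : Mono φ.val := inferInstanceAs (Mono ((SheafOfModules.forget R).map φ))
  PresheafOfModules.injective_of_mono φ.val (op X)

section LinearCombination

variable {I : Type*} [Fintype I]

/-- The linear combination of sections. -/
noncomputable def lc (c : I → R.obj.obj (op X)) (s : I → M.val.obj (op X)) : M.val.obj (op X) :=
  ∑ i, c i • s i

lemma res_lc (f : Y ⟶ X) (c : I → R.obj.obj (op X)) (s : I → M.val.obj (op X)) :
    res M f (lc c s) = lc (fun i ↦ ringRes R f (c i)) (fun i ↦ res M f (s i)) := by
  simp [lc, res_smul]

lemma appHom_lc (φ : M ⟶ N) (c : I → R.obj.obj (op X)) (s : I → M.val.obj (op X)) :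
    appHom φ X (lc c s) = lc c (fun i ↦ appHom φ X (s i)) := by
  simp [lc]

end LinearCombination

lemma exists_of_epi [HasSheafify J AddCommGrpCat.{u}] [J.WEqualsLocallyBijective AddCommGrpCat.{u}]
    (φ : M ⟶ N) [Epi φ] (t : N.val.obj (op X)) :
    Locally J (fun Y (f : Y ⟶ X) ↦ ∃ s, appHom φ Y s = res N f t) := by
  let Q := cokernel φ.val
  let α : Q ⟶ _ := PresheafOfModules.toSheafify (𝟙 R.obj) (CategoryTheory.toSheafify J Q.presheaf)
  let T := (PresheafOfModules.sheafification (𝟙 R.obj)).obj Q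
  let g : N ⟶ T := ⟨cokernel.π φ.val ≫ α⟩
  have hg : g = 0 := by
    rw [← cancel_epi φ]
    ext : 1
    change φ.val ≫ cokernel.π φ.val ≫ α = _
    rw [cokernel.condition_assoc]
    exact zero_comp.trans comp_zero.symm
  have hα : α.app (op X) ((cokernel.π φ.val).app (op X) t) = α.app (op X) 0 := by
    rw [map_zero]
    exact congrArg (fun ψ : N ⟶ T ↦ ψ.val.app (op X) t) hg
  refine ⟨_, Presheaf.equalizerSieve_mem J ((PresheafOfModules.toPresheaf R.obj).map α) _ _ hα, ?_⟩
  intro Y f (hf : Q.map f.op _ = Q.map f.op 0)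
  rw [map_zero, ← PresheafOfModules.naturality_apply] at hf
  let S := ShortComplex.mk _ _ (cokernel.condition φ.val)
  have hS : S.Exact := S.exact_of_g_is_cokernel (cokernelIsCokernel _)
  have hS' := hS.map (PresheafOfModules.evaluation R.obj (op Y))
  rw [ShortComplex.moduleCat_exact_iff] at hS'
  exact hS' _ hf

lemma epi_of_exists (φ : M ⟶ N)
    (h : ∀ (X : C) (t : N.val.obj (op X)),
      Locally J (fun Y (f : Y ⟶ X) ↦ ∃ s, appHom φ Y s = res N f t)) : Epi φ := by
  have : Presheaf.IsLocallySurjective J ((PresheafOfModules.toPresheaf R.obj).map φ.val) :=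
    ⟨fun {X} t ↦ by
      obtain ⟨S, hS, H⟩ := h X t
      refine J.superset_covering (fun Y f hf ↦ ?_) hS
      exact H f hf⟩
  have : Sheaf.IsLocallySurjective ((SheafOfModules.toSheaf R).map φ) := this
  exact (SheafOfModules.toSheaf R).epi_of_epi_map inferInstance

lemma exists_of_exact {S : ShortComplex (SheafOfModules.{u} R)} [HasSheafify J AddCommGrpCat.{u}]
    [J.WEqualsLocallyBijective AddCommGrpCat.{u}] (hS : S.Exact) [Mono S.f]
    (t : S.X₂.val.obj (op X)) (ht : appHom S.g X t = 0) : ∃ s, appHom S.f X s = t := by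
  have hT : IsLimit (KernelFork.ofι ((SheafOfModules.evaluation R (op X)).map S.f) _) :=
    isLimitForkMapOfIsLimit' (SheafOfModules.evaluation R (op X)) S.zero hS.fIsKernel
  have hT' := (S.map (SheafOfModules.evaluation R (op X))).exact_of_f_is_kernel hT
  rw [ShortComplex.moduleCat_exact_iff] at hT'
  exact hT' t ht

lemma exact_iff [HasSheafify J AddCommGrpCat.{u}] [J.WEqualsLocallyBijective AddCommGrpCat.{u}]
    (S : ShortComplex (SheafOfModules.{u} R)) :
    S.Exact ↔ ∀ (X : C) (t : S.X₂.val.obj (op X)), appHom S.g X t = 0 →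
      Locally J (fun Y (f : Y ⟶ X) ↦ ∃ s, appHom S.f Y s = res S.X₂ f t) := by
  have hk (X : C) (t : S.X₂.val.obj (op X)) (ht : appHom S.g X t = 0) :
      ∃ k, appHom (kernel.ι S.g) X k = t :=
    exists_of_exact (S := ShortComplex.mk _ _ (kernel.condition S.g))
      (ShortComplex.exact_of_f_is_kernel _ (kernelIsKernel _)) t ht
  rw [S.exact_iff_epi_kernel_lift]
  constructor
  · intro _ X t ht
    obtain ⟨k, rfl⟩ := hk X t ht
    refine (exists_of_epi (kernel.lift S.g S.f S.zero) k).mono ?_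
    rintro Y f ⟨s, hs⟩
    refine ⟨s, ?_⟩
    rw [← appHom_res, ← hs, ← appHom_comp, kernel.lift_ι]
  · refine fun h ↦ epi_of_exists _ fun X k ↦ ?_
    refine (h X (appHom (kernel.ι S.g) X k) ?_).mono ?_
    · rw [← appHom_comp, kernel.condition]; rfl
    · rintro Y f ⟨s, hs⟩
      refine ⟨s, appHom_injective (kernel.ι S.g) Y ?_⟩
      rw [← appHom_comp, kernel.lift_ι, hs, appHom_res]

section Free

variable {I : Type u} [HasSheafify J AddCommGrpCat.{u}] [J.WEqualsLocallyBijective AddCommGrpCat.{u}]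

/-- The canonical basis of the sections of a free sheaf of modules. -/
noncomputable def freeBasis (X : C) (i : I) :
    (SheafOfModules.free (R := R) I).val.obj (op X) :=
  (SheafOfModules.freeSection i).eval (op X)

lemma res_freeBasis (f : Y ⟶ X) (i : I) :
    res _ f (freeBasis (R := R) X i) = freeBasis Y i :=
  PresheafOfModules.sections_property _ _

lemma free_hom_ext {p q : SheafOfModules.free I ⟶ M}
    (h : ∀ (X : C) (i : I), appHom p X (freeBasis X i) = appHom q X (freeBasis X i)) : p = q :=
  M.freeHomEquiv.injective <| funext fun i ↦
    PresheafOfModules.sections_ext _ _ fun X ↦ h X.unop i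

lemma exists_free_hom {T : C} (hT : IsTerminal T) (s : I → M.val.obj (op T)) :
    ∃ p : SheafOfModules.free I ⟶ M,
      ∀ X i, appHom p X (freeBasis X i) = res M (hT.from X) (s i) := by
  let σ (i : I) : M.sections := PresheafOfModules.sectionsMk
    (fun X ↦ res M (hT.from X.unop) (s i)) fun X Y f ↦ by
      change res M f.unop _ = _
      rw [← res_comp]
      congr 1
      exact congrArg _ (hT.hom_ext _ _)
  refine ⟨M.freeHomEquiv.symm σ, fun X i ↦ ?_⟩
  exact congrArg (fun τ : M.sections ↦ τ.eval (op X))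
    (congrFun (M.freeHomEquiv.apply_symm_apply σ) i)

lemma appHom_freeBasis_eq_res (p : SheafOfModules.free I ⟶ M) (f : Y ⟶ X) (i : I) :
    appHom p Y (freeBasis Y i) = res M f (appHom p X (freeBasis X i)) := by
  rw [← appHom_res, res_freeBasis]

/-- The coordinates of a free sheaf of modules. -/
noncomputable def freeProj [DecidableEq I] (j : I) : SheafOfModules.free I ⟶ SheafOfModules.unit R :=
  Sigma.desc fun i ↦ if i = j then 𝟙 _ else 0

lemma ιFree_freeProj [DecidableEq I] (i j : I) :
    SheafOfModules.ιFree i ≫ freeProj j = if i = j then 𝟙 (SheafOfModules.unit R) else 0 :=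
  Sigma.ι_desc _ _

lemma sum_freeProj_ιFree [DecidableEq I] [Fintype I] :
    ∑ j : I, freeProj j ≫ SheafOfModules.ιFree j = 𝟙 (SheafOfModules.free (R := R) I) := by
  refine Cofan.IsColimit.hom_ext (SheafOfModules.isColimitFreeCofan I) _ _ fun i ↦ ?_
  change SheafOfModules.ιFree i ≫ _ = SheafOfModules.ιFree i ≫ _
  simp [Preadditive.comp_sum, reassoc_of% ιFree_freeProj, ite_comp]

lemma appHom_ιFree (i : I) (c : R.obj.obj (op X)) :
    appHom (SheafOfModules.ιFree i) X c = c • freeBasis X i := by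
  have h : appHom (SheafOfModules.ιFree (R := R) i) X (1 : R.obj.obj (op X)) = freeBasis X i := by
    conv_lhs => rw [← Category.comp_id (SheafOfModules.ιFree (R := R) i)]
    rfl
  rw [← h]
  refine Eq.trans (congrArg _ ?_) ((appHom (SheafOfModules.ιFree (R := R) i) X).map_smul c _)
  exact (mul_one c).symm

lemma appHom_freeProj_freeBasis [DecidableEq I] (i j : I) :
    appHom (freeProj j) X (freeBasis X i) = if i = j then (1 : R.obj.obj (op X)) else 0 := by
  have h : freeBasis (R := R) X i = appHom (SheafOfModules.ιFree i) X (1 : R.obj.obj (op X)) := by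
    rw [appHom_ιFree, one_smul]
  rw [h]
  change appHom (SheafOfModules.ιFree i ≫ freeProj j) X (1 : R.obj.obj (op X)) = _
  rw [ιFree_freeProj]
  split_ifs <;> rfl

variable [Fintype I] {K : Type u} [Fintype K]

lemma exists_lc_freeBasis (z : (SheafOfModules.free (R := R) I).val.obj (op X)) :
    ∃ c : I → R.obj.obj (op X), lc c (freeBasis X) = z := by
  classical
  refine ⟨fun j ↦ appHom (freeProj j) X z, ?_⟩
  have h := appHom_sum Finset.univ
    (fun j : I ↦ freeProj (R := R) j ≫ SheafOfModules.ιFree j) z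
  rw [sum_freeProj_ιFree] at h
  refine Eq.trans ?_ h.symm
  exact Finset.sum_congr rfl fun j _ ↦ (appHom_ιFree j _).symm

lemma lc_freeBasis_injective :
    Function.Injective fun c : I → R.obj.obj (op X) ↦ lc c (freeBasis (R := R) X) := by
  classical
  have key (c : I → R.obj.obj (op X)) (j : I) :
      appHom (freeProj j) X (lc c (freeBasis (R := R) X)) = c j := by
    rw [appHom_lc]
    change ∑ i, c i • _ = _
    rw [Finset.sum_eq_single j]
    · rw [appHom_freeProj_freeBasis, if_pos rfl]
      exact mul_one (c j)
    · intro i _ hij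
      rw [appHom_freeProj_freeBasis, if_neg hij]
      exact mul_zero (c i)
    · simp
  intro c d h
  funext j
  rw [← key c j, ← key d j]
  exact congrArg _ h

lemma epi_iff_lc (p : SheafOfModules.free I ⟶ M) :
    Epi p ↔ ∀ (X : C) (t : M.val.obj (op X)), Locally J (fun Y (f : Y ⟶ X) ↦
      ∃ c : I → R.obj.obj (op Y), lc c (fun i ↦ appHom p Y (freeBasis Y i)) = res M f t) := by
  constructor
  · intro _ X t
    refine (exists_of_epi p t).mono ?_
    rintro Y f ⟨z, hz⟩
    obtain ⟨c, rfl⟩ := exists_lc_freeBasis z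
    exact ⟨c, by rw [← appHom_lc, hz]⟩
  · refine fun h ↦ epi_of_exists p fun X t ↦ (h X t).mono ?_
    rintro Y f ⟨c, hc⟩
    exact ⟨lc c (freeBasis Y), by rw [appHom_lc, hc]⟩

lemma exact_iff_lc (f : SheafOfModules.free K ⟶ SheafOfModules.free I)
    (p : SheafOfModules.free I ⟶ M) (w : f ≫ p = 0)
    (a : ∀ X : C, K → I → R.obj.obj (op X))
    (ha : ∀ X j, appHom f X (freeBasis X j) = lc (a X j) (freeBasis X)) :
    (ShortComplex.mk f p w).Exact ↔ ∀ (X : C) (c : I → R.obj.obj (op X)),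
      lc c (fun i ↦ appHom p X (freeBasis X i)) = 0 → Locally J (fun Y (g : Y ⟶ X) ↦
        ∃ d : K → R.obj.obj (op Y), ∀ i, ringRes R g (c i) = ∑ j, d j * a Y j i) := by
  have key {X : C} (d : K → R.obj.obj (op X)) :
      appHom f X (lc d (freeBasis X)) = lc (fun i ↦ ∑ j, d j * a X j i) (freeBasis X) := by
    rw [appHom_lc]
    simp only [ha, lc, Finset.smul_sum, Finset.sum_smul, mul_smul]
    exact Finset.sum_comm
  have key' {X Y : C} (g : Y ⟶ X) (c : I → R.obj.obj (op X)) :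
      res _ g (lc c (freeBasis X)) = lc (fun i ↦ ringRes R g (c i)) (freeBasis Y) := by
    simp only [res_lc, res_freeBasis]
  rw [exact_iff]
  constructor
  · intro h X c hc
    refine (h X (lc c (freeBasis X)) (by rw [appHom_lc]; exact hc)).mono ?_
    rintro Y g ⟨z, hz⟩
    obtain ⟨d, rfl⟩ := exists_lc_freeBasis z
    refine ⟨d, fun i ↦ ?_⟩
    erw [key, key'] at hz
    exact (congrFun (lc_freeBasis_injective hz) i).symm
  · intro h X z hz
    obtain ⟨c, rfl⟩ := exists_lc_freeBasis z
    refine (h X c (by rw [← appHom_lc]; exact hz)).mono ?_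
    rintro Y g ⟨d, hd⟩
    refine ⟨lc d (freeBasis Y), ?_⟩
    erw [key, key']
    simp only [hd]

end Free

section Generators

/-- Sections of `M` over `U` generate `M` over `U` if every section of `M` over an object over `U`
is locally a linear combination of them. -/
def Generates (M : SheafOfModules.{u} R) {U : C} {I : Type*} [Fintype I]
    (s : I → M.val.obj (op U)) : Prop :=
  ∀ ⦃Y : C⦄ (h : Y ⟶ U) (t : M.val.obj (op Y)), Locally J (fun Z (f : Z ⟶ Y) ↦
    ∃ c : I → R.obj.obj (op Z), lc c (fun i ↦ res M (f ≫ h) (s i)) = res M f t)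

/-- A family of relations between sections of `M` over `U` is complete if every relation between
their restrictions is locally a linear combination of the given ones. -/
structure IsRelations (M : SheafOfModules.{u} R) {U : C} {I K : Type*} [Fintype I] [Fintype K]
    (s : I → M.val.obj (op U)) (a : K → I → R.obj.obj (op U)) : Prop where
  lc_eq_zero (j : K) : lc (a j) s = 0
  exists_eq ⦃Y : C⦄ (h : Y ⟶ U) (c : I → R.obj.obj (op Y))
    (hc : lc c (fun i ↦ res M h (s i)) = 0) : Locally J (fun Z (f : Z ⟶ Y) ↦
      ∃ d : K → R.obj.obj (op Z), ∀ i, ringRes R f (c i) = ∑ j, d j * ringRes R (f ≫ h) (a j i))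

variable {I K L : Type*} [Fintype I] [Fintype K] [Fintype L] {U V : C}
  {s : I → M.val.obj (op U)} {a : K → I → R.obj.obj (op U)}

lemma Generates.res (hs : Generates M s) (g : V ⟶ U) : Generates M (fun i ↦ res M g (s i)) := by
  intro Y h t
  simpa only [← res_comp, Category.assoc] using hs (h ≫ g) t

lemma IsRelations.res (ha : IsRelations M s a) (g : V ⟶ U) :
    IsRelations M (fun i ↦ res M g (s i)) (fun j i ↦ ringRes R g (a j i)) where
  lc_eq_zero j := by rw [← res_lc, ha.lc_eq_zero, map_zero]
  exists_eq Y h c hc := by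
    simp only [← res_comp] at hc
    simpa only [← ringRes_comp, Category.assoc] using ha.exists_eq (h ≫ g) c hc

lemma lc_comp_equiv {I' : Type*} [Fintype I'] (e : I' ≃ I) (c : I → R.obj.obj (op U))
    (s : I → M.val.obj (op U)) : lc (c ∘ e) (s ∘ e) = lc c s :=
  e.sum_comp fun i ↦ c i • s i

lemma Generates.comp_equiv (hs : Generates M s) {I' : Type*} [Fintype I'] (e : I' ≃ I) :
    Generates M (s ∘ e) := fun Y h t ↦ (hs h t).mono <| by
  rintro Z f ⟨c, hc⟩
  exact ⟨c ∘ e, (lc_comp_equiv e c fun i ↦ CoherentSheaves.res M (f ≫ h) (s i)).trans hc⟩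

lemma IsRelations.comp_equiv (ha : IsRelations M s a) {I' K' : Type*} [Fintype I'] [Fintype K']
    (e : I' ≃ I) (e' : K' ≃ K) : IsRelations M (s ∘ e) (fun j i ↦ a (e' j) (e i)) where
  lc_eq_zero j := (lc_comp_equiv e (a (e' j)) s).trans (ha.lc_eq_zero _)
  exists_eq Y h c hc := by
    have hc' : lc (c ∘ e.symm) (fun i ↦ CoherentSheaves.res M h (s i)) = 0 := by
      rw [← lc_comp_equiv e, ← hc]
      congr 1
      funext i
      simp
    refine (ha.exists_eq h _ hc').mono ?_
    rintro Z f ⟨d, hd⟩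
    refine ⟨d ∘ e', fun i ↦ ?_⟩
    have := hd (e i)
    simp only [Function.comp_apply, Equiv.symm_apply_apply] at this
    rw [this]
    exact (e'.sum_comp fun j ↦ d j * ringRes R (f ≫ h) (a j (e i))).symm

lemma Generates.map (hs : Generates M s) (q : M ⟶ N)
    (hq : ∀ (X : C) (t : N.val.obj (op X)),
      Locally J (fun Y (f : Y ⟶ X) ↦ ∃ n, appHom q Y n = CoherentSheaves.res N f t)) :
    Generates N (fun i ↦ appHom q U (s i)) := by
  intro Y h t
  refine (hq Y t).bind ?_
  rintro Z f ⟨n, hn⟩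
  refine (hs (f ≫ h) n).mono ?_
  rintro W g ⟨c, hc⟩
  refine ⟨c, ?_⟩
  rw [res_comp, ← hn, ← appHom_res, ← hc, appHom_lc]
  simp only [appHom_res, Category.assoc]

section Extension

variable {A D : SheafOfModules.{u} R} {k : A ⟶ M} {q : M ⟶ D} {s' : L → A.val.obj (op U)}

lemma Generates.extension (hq : ∀ (X : C) (n : M.val.obj (op X)), appHom q X n = 0 →
      ∃ x, appHom k X x = n)
    (hs : Generates D (fun i ↦ appHom q U (s i))) (hs' : Generates A s') :
    Generates M (Sum.elim s fun l ↦ appHom k U (s' l)) := by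
  intro Y h t
  refine (hs h (appHom q Y t)).bind ?_
  rintro Z f ⟨c, hc⟩
  obtain ⟨x, hx⟩ := hq Z (CoherentSheaves.res M f t -
      lc c (fun i ↦ CoherentSheaves.res M (f ≫ h) (s i))) (by
    rw [map_sub, appHom_res, ← hc, appHom_lc]
    simp only [appHom_res, sub_self])
  refine (hs' (f ≫ h) x).mono ?_
  rintro W g ⟨d, hd⟩
  refine ⟨Sum.elim (fun i ↦ ringRes R g (c i)) d, ?_⟩
  have hx' := congrArg (CoherentSheaves.res M g) hx
  rw [← appHom_res, ← hd, map_sub, res_lc, eq_sub_iff_add_eq', appHom_lc] at hx'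
  rw [res_comp, ← hx']
  simp only [lc, Fintype.sum_sum_type, Sum.elim_inl, Sum.elim_inr, appHom_res, ← res_comp,
    Category.assoc]

lemma IsRelations.extension (hkq : k ≫ q = 0)
    (hq : ∀ (X : C) (n : M.val.obj (op X)), appHom q X n = 0 → ∃ x, appHom k X x = n)
    (ha : IsRelations M s a) (hs' : Generates A s') {b : L → I → R.obj.obj (op U)}
    (hb : ∀ l, lc (b l) s = appHom k U (s' l)) :
    IsRelations D (fun i ↦ appHom q U (s i)) (Sum.elim a b) where
  lc_eq_zero j := by
    rw [← appHom_lc]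
    obtain j | l := j
    · rw [Sum.elim_inl, ha.lc_eq_zero, map_zero]
    · rw [Sum.elim_inr, hb, ← appHom_comp, hkq, appHom_zero]
  exists_eq Y h c hc := by
    simp only [← appHom_res, ← appHom_lc] at hc
    obtain ⟨x, hx⟩ := hq _ _ hc
    refine (hs' h x).bind ?_
    rintro Z f ⟨d, hd⟩
    have hx' := congrArg (CoherentSheaves.res M f) hx
    rw [← appHom_res, ← hd, res_lc, appHom_lc] at hx'
    simp only [appHom_res, ← hb, res_lc, ← res_comp] at hx'
    have hr : lc (fun i ↦ ringRes R f (c i) - ∑ l, d l * ringRes R (f ≫ h) (b l i))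
        (fun i ↦ CoherentSheaves.res M (f ≫ h) (s i)) = 0 := by
      simp only [lc, sub_smul, Finset.sum_sub_distrib, Finset.sum_smul, mul_smul] at hx' ⊢
      rw [← hx', sub_eq_zero, Finset.sum_comm]
      simp only [Finset.smul_sum]
    refine (ha.exists_eq (f ≫ h) _ hr).mono ?_
    rintro W g ⟨e, he⟩
    refine ⟨Sum.elim e fun l ↦ ringRes R g (d l), fun i ↦ ?_⟩
    have := he i
    rw [map_sub, sub_eq_iff_eq_add] at this
    rw [ringRes_comp, this, Fintype.sum_sum_type]
    simp only [Sum.elim_inl, Sum.elim_inr, map_sum, map_mul, ← ringRes_comp, Category.assoc]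

end Extension

end Generators

end Sections

section Over
variable {C : Type u'} [Category.{v'} C] {J : GrothendieckTopology C}

lemma locally_over_iff {U : C} {Y : Over U} {P : ∀ ⦃Z : C⦄, (Z ⟶ Y.left) → Prop} :
    Locally (J.over U) (X := Y) (fun _ f ↦ P f.left) ↔ Locally J P := by
  refine ⟨fun ⟨S, hS, H⟩ ↦ ⟨Sieve.overEquiv Y S, (J.mem_over_iff S).1 hS, fun Z f hf ↦ ?_⟩,
    Locally.of_left⟩
  exact H _ ((Sieve.overEquiv_iff S f).1 hf)

variable {R : Sheaf J RingCat.{u}} {M : SheafOfModules.{u} R} {I K : Type*} [Fintype I] [Fintype K]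

lemma generates_over_iff {U : C} {Y : Over U} {s : I → M.val.obj (op Y.left)} :
    Generates (M.over U) (U := Y) s ↔ Generates M s := by
  refine ⟨fun H Z h t ↦ ?_, fun H Z h t ↦ ?_⟩
  · rw [← locally_over_iff (Y := Over.mk (h ≫ Y.hom))]
    exact H (Over.homMk h : Over.mk (h ≫ Y.hom) ⟶ Y) t
  · exact Locally.of_left (H h.left t)

lemma isRelations_over_iff {U : C} {Y : Over U} {s : I → M.val.obj (op Y.left)}
    {a : K → I → R.obj.obj (op Y.left)} :
    IsRelations (M.over U) (U := Y) s a ↔ IsRelations M s a := by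
  refine ⟨fun H ↦ ⟨H.lc_eq_zero, fun Z h c hc ↦ ?_⟩, fun H ↦ ⟨H.lc_eq_zero, fun Z h c hc ↦ ?_⟩⟩
  · rw [← locally_over_iff (Y := Over.mk (h ≫ Y.hom))]
    exact H.exists_eq (Over.homMk h : Over.mk (h ≫ Y.hom) ⟶ Y) c hc
  · exact Locally.of_left (H.exists_eq h.left c hc)

end Over

section Presentation
variable {C : Type u'} [Category.{v'} C] {J : GrothendieckTopology C} {R : Sheaf J RingCat.{u}}
  [HasSheafify J AddCommGrpCat.{u}] [J.WEqualsLocallyBijective AddCommGrpCat.{u}]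
  {M : SheafOfModules.{u} R} {I K : Type u} [Fintype I] [Fintype K] {T : C}

lemma epi_iff_generates (hT : IsTerminal T) (p : SheafOfModules.free I ⟶ M) :
    Epi p ↔ Generates M fun i ↦ appHom p T (freeBasis T i) := by
  rw [epi_iff_lc]
  simp only [Generates, ← appHom_freeBasis_eq_res]
  exact ⟨fun H Y _ ↦ H Y, fun H Y ↦ H (hT.from Y)⟩

lemma exists_epi_iff_generates (hT : IsTerminal T) :
    (∃ p : SheafOfModules.free I ⟶ M, Epi p) ↔
      ∃ s : I → M.val.obj (op T), Generates M s := by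
  refine ⟨fun ⟨p, hp⟩ ↦ ⟨_, (epi_iff_generates hT p).1 hp⟩, fun ⟨s, hs⟩ ↦ ?_⟩
  obtain ⟨p, hp⟩ := exists_free_hom hT s
  refine ⟨p, (epi_iff_generates hT p).2 ?_⟩
  simp only [hp]
  exact hs.res _

lemma exact_iff_isRelations (hT : IsTerminal T)
    (f : SheafOfModules.free K ⟶ SheafOfModules.free I)
    (p : SheafOfModules.free I ⟶ M) (w : f ≫ p = 0) (a : K → I → R.obj.obj (op T))
    (ha : ∀ j, appHom f T (freeBasis T j) = lc (a j) (freeBasis T)) :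
    (ShortComplex.mk f p w).Exact ↔ IsRelations M (fun i ↦ appHom p T (freeBasis T i)) a := by
  have ha' (X : C) (j : K) : appHom f X (freeBasis X j) =
      lc (fun i ↦ ringRes R (hT.from X) (a j i)) (freeBasis X) := by
    rw [appHom_freeBasis_eq_res f (hT.from X), ha, res_lc]
    simp only [res_freeBasis]
  rw [exact_iff_lc f p w _ ha']
  refine ⟨fun H ↦ ⟨fun j ↦ ?_, fun Y h c hc ↦ ?_⟩, fun H Y c hc ↦ ?_⟩
  · rw [← appHom_lc, ← ha, ← appHom_comp, w, appHom_zero]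
  · simp only [← appHom_freeBasis_eq_res] at hc
    simpa only [hT.hom_ext _ (hT.from _)] using H Y c hc
  · simp only [appHom_freeBasis_eq_res p (hT.from Y)] at hc
    simpa only [hT.hom_ext _ (hT.from _)] using H.exists_eq (hT.from Y) c hc

lemma exists_presentation_iff (hT : IsTerminal T) :
    (∃ (f : SheafOfModules.free K ⟶ SheafOfModules.free I) (p : SheafOfModules.free I ⟶ M)
      (w : f ≫ p = 0), Epi p ∧ (ShortComplex.mk f p w).Exact) ↔
      ∃ (s : I → M.val.obj (op T)) (a : K → I → R.obj.obj (op T)),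
        Generates M s ∧ IsRelations M s a := by
  constructor
  · rintro ⟨f, p, w, hp, hf⟩
    choose a ha using fun j ↦ exists_lc_freeBasis (appHom f T (freeBasis T j))
    exact ⟨_, a, (epi_iff_generates hT p).1 hp,
      (exact_iff_isRelations hT f p w a fun j ↦ (ha j).symm).1 hf⟩
  · rintro ⟨s, a, hs, ha⟩
    obtain ⟨p, hp⟩ := exists_free_hom hT s
    obtain ⟨f, hf⟩ := exists_free_hom hT fun j ↦ lc (a j) (freeBasis (R := R) T)
    have hs' := hs.res (hT.from T)
    have ha' := ha.res (hT.from T)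
    simp only [← hp] at hs' ha'
    have hf' (X : C) (j : K) : appHom f X (freeBasis X j) =
        lc (fun i ↦ ringRes R (hT.from X) (a j i)) (freeBasis X) := by
      rw [hf, res_lc]
      simp only [res_freeBasis]
    have w : f ≫ p = 0 := free_hom_ext fun X j ↦ by
      rw [appHom_comp, hf', appHom_lc, appHom_zero]
      simp only [hp]
      rw [← res_lc, ha.lc_eq_zero, map_zero]
    exact ⟨f, p, w, (epi_iff_generates hT p).2 hs',
      (exact_iff_isRelations hT f p w _ fun j ↦ hf' T j).2 ha'⟩

end Presentation

variable {X : TopCat.{u}} {R : Sheaf (Opens.grothendieckTopology X) RingCat.{u}}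

section Opens

lemma Locally.exists_nhds_over {U : Opens X} {Y : Over U} {P : ∀ ⦃Z : Over U⦄, (Z ⟶ Y) → Prop}
    (h : Locally ((Opens.grothendieckTopology X).over U) P) {x : X} (hx : x ∈ Y.left) :
    ∃ (Z : Over U) (f : Z ⟶ Y), x ∈ Z.left ∧ P f := by
  obtain ⟨S, hS, H⟩ := h
  obtain ⟨V, f, hf, hxV⟩ := (GrothendieckTopology.mem_over_iff _ S).1 hS x hx
  exact ⟨_, _, hxV, H _ ((Sieve.overEquiv_iff S f).1 hf)⟩

lemma isLFG_iff {M : SheafOfModules.{u} R} :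
    IsLFG M ↔ ∀ x : X, ∃ U : Opens X, x ∈ U ∧ ∃ n : ℕ, 0 < n ∧
      ∃ s : ULift.{u} (Fin n) → M.val.obj (op U), Generates M s := by
  refine forall_congr' fun x ↦ exists_congr fun U ↦ and_congr_right fun _ ↦
    exists_congr fun n ↦ and_congr_right fun _ ↦ ?_
  rw [exists_epi_iff_generates Over.mkIdTerminal]
  exact exists_congr fun s ↦ generates_over_iff (Y := Over.mk (𝟙 U))

variable {U : Opens X} {N : SheafOfModules.{u} (R.over U)}

lemma isLFGOver_iff :
    IsLFGOver N ↔ ∀ x ∈ U, ∃ (V : Opens X) (h : V ≤ U), x ∈ V ∧ ∃ n : ℕ, 0 < n ∧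
      ∃ s : ULift.{u} (Fin n) → N.val.obj (op (Over.mk (homOfLE h))), Generates N s := by
  refine forall₂_congr fun x _ ↦ exists₂_congr fun V h ↦ and_congr_right fun _ ↦
    exists_congr fun n ↦ and_congr_right fun _ ↦ ?_
  rw [exists_epi_iff_generates Over.mkIdTerminal]
  exact exists_congr fun s ↦ generates_over_iff (Y := Over.mk (𝟙 (Over.mk (homOfLE h))))

lemma isLFPOver_iff :
    IsLFPOver N ↔ ∀ x ∈ U, ∃ (V : Opens X) (h : V ≤ U), x ∈ V ∧ ∃ m n : ℕ, 0 < m ∧ 0 < n ∧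
      ∃ (s : ULift.{u} (Fin n) → N.val.obj (op (Over.mk (homOfLE h))))
        (a : ULift.{u} (Fin m) → ULift.{u} (Fin n) → (R.over U).obj.obj (op (Over.mk (homOfLE h)))),
        Generates N s ∧ IsRelations N s a := by
  refine forall₂_congr fun x _ ↦ exists₂_congr fun V h ↦ and_congr_right fun _ ↦
    exists₂_congr fun m n ↦ and_congr_right fun _ ↦ and_congr_right fun _ ↦ ?_
  rw [exists_presentation_iff Over.mkIdTerminal]
  exact exists₂_congr fun s a ↦ and_congr
    (generates_over_iff (Y := Over.mk (𝟙 (Over.mk (homOfLE h)))))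
    (isRelations_over_iff (Y := Over.mk (𝟙 (Over.mk (homOfLE h)))))

lemma IsLFGOver.of_generates (H : ∀ x ∈ U, ∃ Y : Over U, x ∈ Y.left ∧
    ∃ (I : Type u) (_ : Fintype I) (_ : Nonempty I) (s : I → N.val.obj (op Y)), Generates N s) :
    IsLFGOver N := by
  refine isLFGOver_iff.2 fun x hx ↦ ?_
  obtain ⟨Y, hxY, I, _, _, s, hs⟩ := H x hx
  let e : ULift.{u} (Fin (Fintype.card I)) ≃ I := Equiv.ulift.trans (Fintype.equivFin I).symm
  exact ⟨Y.left, Y.hom.le, hxY, _, Fintype.card_pos, s ∘ e, hs.comp_equiv e⟩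

lemma IsLFPOver.of_generates (H : ∀ x ∈ U, ∃ Y : Over U, x ∈ Y.left ∧
    ∃ (I K : Type u) (_ : Fintype I) (_ : Fintype K) (_ : Nonempty I) (_ : Nonempty K)
      (s : I → N.val.obj (op Y)) (a : K → I → (R.over U).obj.obj (op Y)),
      Generates N s ∧ IsRelations N s a) :
    IsLFPOver N := by
  refine isLFPOver_iff.2 fun x hx ↦ ?_
  obtain ⟨Y, hxY, I, K, _, _, _, _, s, a, hs, ha⟩ := H x hx
  let e : ULift.{u} (Fin (Fintype.card I)) ≃ I := Equiv.ulift.trans (Fintype.equivFin I).symm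
  let e' : ULift.{u} (Fin (Fintype.card K)) ≃ K := Equiv.ulift.trans (Fintype.equivFin K).symm
  exact ⟨Y.left, Y.hom.le, hxY, _, _, Fintype.card_pos, Fintype.card_pos, s ∘ e, _,
    hs.comp_equiv e, ha.comp_equiv e e'⟩

lemma IsLFG.over {M : SheafOfModules.{u} R} (hM : IsLFG M) (U : Opens X) :
    IsLFGOver (M.over U) := by
  refine IsLFGOver.of_generates fun x hx ↦ ?_
  obtain ⟨V, hxV, n, hn, s, hs⟩ := isLFG_iff.1 hM x
  have := Fin.pos_iff_nonempty.1 hn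
  refine ⟨Over.mk (homOfLE inf_le_left : U ⊓ V ⟶ U), ⟨hx, hxV⟩, _, inferInstance, inferInstance,
    _, generates_over_iff.2 (hs.res (homOfLE inf_le_right))⟩

lemma IsLFGOver.of_extension {A D : SheafOfModules.{u} (R.over U)} {k : A ⟶ N} {q : N ⟶ D}
    (hkq : ∀ (Y : Over U) (n : N.val.obj (op Y)), appHom q Y n = 0 → ∃ x, appHom k Y x = n)
    (hq : ∀ (Y : Over U) (t : D.val.obj (op Y)), Locally ((Opens.grothendieckTopology X).over U)
      (fun Z (f : Z ⟶ Y) ↦ ∃ n, appHom q Z n = res D f t))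
    (hA : IsLFGOver A) (hD : IsLFGOver D) : IsLFGOver N := by
  refine IsLFGOver.of_generates fun x hx ↦ ?_
  obtain ⟨V, hV, hxV, m, hm, s', hs'⟩ := isLFGOver_iff.1 hA x hx
  obtain ⟨W, hW, hxW, n, hn, s, hs⟩ := isLFGOver_iff.1 hD x hx
  have := Fin.pos_iff_nonempty.1 hn
  let f : Over.mk (homOfLE (inf_le_left.trans hV) : V ⊓ W ⟶ U) ⟶ Over.mk (homOfLE hV) :=
    Over.homMk (homOfLE inf_le_left)
  let g : Over.mk (homOfLE (inf_le_left.trans hV) : V ⊓ W ⟶ U) ⟶ Over.mk (homOfLE hW) :=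
    Over.homMk (homOfLE inf_le_right)
  obtain ⟨Z, i, hxZ, hZ⟩ := (Locally.forall_finite fun l ↦ hq _ (res D g (s l))).exists_nhds_over
    (x := x) ⟨hxV, hxW⟩
  choose t ht using hZ
  refine ⟨Z, hxZ, _, inferInstance, inferInstance, _,
    Generates.extension (s := t) hkq ?_ (hs'.res (i ≫ f))⟩
  simp only [ht, ← res_comp]
  exact hs.res _

lemma IsLFPOver.of_extension {A D : SheafOfModules.{u} (R.over U)} {k : A ⟶ N} {q : N ⟶ D}
    (w : k ≫ q = 0)
    (hkq : ∀ (Y : Over U) (n : N.val.obj (op Y)), appHom q Y n = 0 → ∃ x, appHom k Y x = n)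
    (hq : ∀ (Y : Over U) (t : D.val.obj (op Y)), Locally ((Opens.grothendieckTopology X).over U)
      (fun Z (f : Z ⟶ Y) ↦ ∃ n, appHom q Z n = res D f t))
    (hA : IsLFGOver A) (hN : IsLFPOver N) : IsLFPOver D := by
  refine IsLFPOver.of_generates fun x hx ↦ ?_
  obtain ⟨V, hV, hxV, l, hl, s', hs'⟩ := isLFGOver_iff.1 hA x hx
  obtain ⟨W, hW, hxW, m, n, hm, hn, s, a, hs, ha⟩ := isLFPOver_iff.1 hN x hx
  have := Fin.pos_iff_nonempty.1 hn
  have := Fin.pos_iff_nonempty.1 hm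
  let f : Over.mk (homOfLE (inf_le_left.trans hV) : V ⊓ W ⟶ U) ⟶ Over.mk (homOfLE hV) :=
    Over.homMk (homOfLE inf_le_left)
  let g : Over.mk (homOfLE (inf_le_left.trans hV) : V ⊓ W ⟶ U) ⟶ Over.mk (homOfLE hW) :=
    Over.homMk (homOfLE inf_le_right)
  obtain ⟨Z, i, hxZ, hZ⟩ := (Locally.forall_finite fun j ↦
    hs g (appHom k _ (res A f (s' j)))).exists_nhds_over (x := x) ⟨hxV, hxW⟩
  choose b hb using hZ
  refine ⟨Z, hxZ, _, _, inferInstance, inferInstance, inferInstance, inferInstance, _, _,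
    (hs.res (i ≫ g)).map q hq, (ha.res (i ≫ g)).extension w hkq (hs'.res (i ≫ f)) (b := b) ?_⟩
  intro j
  rw [hb, ← appHom_res, res_comp]

lemma epi_resMap {M N : SheafOfModules.{u} R} (φ : M ⟶ N) [Epi φ] (U : Opens X) :
    Epi (resMap φ U) := by
  refine epi_of_exists _ fun Y t ↦ ?_
  have h := exists_of_epi (X := Y.left) φ t
  exact h.of_left

lemma resMap_comp_eq_zero {M N P : SheafOfModules.{u} R} {φ : M ⟶ N} {ψ : N ⟶ P} (w : φ ≫ ψ = 0)
    (U : Opens X) : resMap φ U ≫ resMap ψ U = 0 := by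
  ext Y t
  exact LinearMap.congr_fun (congrArg (appHom · Y.unop.left) w) t

end Opens

/-- In a short exact sequence, if `M` is coherent and `M'` is locally finitely
generated, then `M''` is coherent. -/
theorem isCoherent_of_isCoherent_isLFG (S : CategoryTheory.ShortComplex (SheafOfModules.{u} R)) (hS : S.ShortExact)
    (hM : IsCoherent S.X₂) (hM' : IsLFG S.X₁) : IsCoherent S.X₃ := by
  have := hS.mono_f
  have := hS.epi_g
  refine ⟨isLFG_iff.2 fun x ↦ ?_, fun U N'' ι hι hN'' ↦ ?_⟩
  · obtain ⟨U, hxU, n, hn, s, hs⟩ := isLFG_iff.1 hM.1 x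
    exact ⟨U, hxU, n, hn, _, hs.map S.g fun _ ↦ exists_of_epi S.g⟩
  · have := epi_resMap S.g U
    let q := pullback.fst ι (resMap S.g U)
    let j := pullback.snd ι (resMap S.g U)
    have hqj : q ≫ ι = j ≫ resMap S.g U := pullback.condition
    let k : S.X₁.over U ⟶ pullback ι (resMap S.g U) :=
      pullback.lift 0 (resMap S.f U) (by rw [zero_comp, resMap_comp_eq_zero S.zero U])
    have hkq : k ≫ q = 0 := pullback.lift_fst _ _ _
    have hkj : k ≫ j = resMap S.f U := pullback.lift_snd _ _ _
    have hker (Y : Over U) (n : (pullback ι (resMap S.g U)).val.obj (op Y))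
        (hn : appHom q Y n = 0) : ∃ a, appHom k Y a = n := by
      have hj : appHom (resMap S.g U) Y (appHom j Y n) = 0 := by
        rw [← appHom_comp, ← hqj, appHom_comp, hn, map_zero]
      obtain ⟨a, ha⟩ : ∃ a, appHom (resMap S.f U) Y a = appHom j Y n :=
        exists_of_exact (X := Y.left) hS.exact (appHom j Y n) hj
      refine ⟨a, appHom_injective j Y ?_⟩
      rw [← appHom_comp, hkj, ha]
    have hq (Y : Over U) (t : N''.val.obj (op Y)) := exists_of_epi q t
    have hX₁ := hM'.over U
    have hN : IsLFGOver (pullback ι (resMap S.g U)) := .of_extension hker hq hX₁ hN''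
    exact .of_extension hkq hker hq hX₁ (hM.2 U _ j inferInstance hN)

end CoherentSheaves
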